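/- Let c > 0 and β > -1 be real, set A(x) = (β+1)|log(1-x)| + β·log|log(1-x)| + β·log(β+1) + log c. Fix an integer d ≥ 1, reals t_1 > t_2 > ⋯ > t_d, and δ > 0 small enough that the intervals [t_i, t_i+δ] are pairwise disjoint. Then as x → 1⁻, the quantity [∏_{i=1}^d Σ_{k ∈ ℕ, (A(x)+t_i)/(1-x) ≤ k ≤ (A(x)+t_i+δ)/(1-x)} c·k^β·x^k] · [∏_{k ∈ ℕ, k > (A(x)+t_d)/(1-x)} (1-x^k)^{c·k^β}] converges to exp(-e^{-t_d}) · ∏_{i=1}^d e^{-t_i}·(1 - e^{-δ}). -/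

import Mathlib

open Filter Topology

theorem one_add_rpow_le_exp {β u : ℝ} (hβ : 0 ≤ β) (hu : 0 ≤ u) :
    (1 + u) ^ β ≤ Real.exp (β * u) := by
  rw [mul_comm, Real.exp_mul]
  exact Real.rpow_le_rpow (by positivity) (by linarith [Real.add_one_le_exp u]) hβ

theorem exp_le_one_add_rpow {β u : ℝ} (hβ : β ≤ 0) (hu : 0 ≤ u) :
    Real.exp (β * u) ≤ (1 + u) ^ β := by
  rw [mul_comm, Real.exp_mul]
  exact Real.rpow_le_rpow_of_nonpos (by positivity) (by linarith [Real.add_one_le_exp u]) hβ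

theorem tendsto_one_sub_nhdsLT_one : Tendsto (fun x : ℝ => 1 - x) (𝓝[<] 1) (𝓝[>] 0) := by
  refine tendsto_nhdsWithin_iff.2 ⟨?_, ?_⟩
  · have : Tendsto (fun x : ℝ => 1 - x) (𝓝 1) (𝓝 (1 - 1)) := by
      exact (continuous_const.sub continuous_id).tendsto 1
    simpa using this.mono_left nhdsWithin_le_nhds
  · filter_upwards [self_mem_nhdsWithin] with x hx
    simpa using hx

theorem eventually_mem_Ioo_nhdsLT_one : ∀ᶠ x : ℝ in 𝓝[<] 1, 0 < x ∧ x < 1 :=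
  Ioo_mem_nhdsLT one_pos

theorem tendsto_ratio_mul_exp {β : ℝ} {N : ℝ → ℕ}
    (hN : Tendsto (fun x => N x * (1 - x)) (𝓝[<] 1) atTop) :
    Tendsto (fun x => (1 - x * Real.exp (β / N x)) / (1 - x)) (𝓝[<] 1) (𝓝 1) := by
  have h0 : Tendsto (fun x : ℝ => 1 - x) (𝓝[<] 1) (𝓝 0) :=
    tendsto_one_sub_nhdsLT_one.mono_right nhdsWithin_le_nhds
  have hinv : Tendsto (fun x => β / (N x * (1 - x))) (𝓝[<] 1) (𝓝 0) :=
    hN.const_div_atTop β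
  have hu : Tendsto (fun x => β / N x) (𝓝[<] 1) (𝓝 0) := by
    have := hinv.mul h0
    rw [mul_zero] at this
    refine this.congr' ?_
    filter_upwards [eventually_mem_Ioo_nhdsLT_one, hN.eventually_gt_atTop 0] with x hx hx2
    have : (1 - x) ≠ 0 := by linarith [hx.2]
    have : (N x : ℝ) ≠ 0 := by rintro h; simp [h] at hx2
    field_simp
  have hz : Tendsto (fun x => (Real.exp (β / N x) - 1) / (1 - x)) (𝓝[<] 1) (𝓝 0) := by
    have hb : Tendsto (fun x => 2 * |β / (N x * (1 - x))|) (𝓝[<] 1) (𝓝 0) := by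
      simpa using hinv.abs.const_mul 2
    refine squeeze_zero_norm' ?_ hb
    filter_upwards [eventually_mem_Ioo_nhdsLT_one,
      hu.abs.eventually (ge_mem_nhds (show |(0 : ℝ)| < 1 by simp))] with x hx hx2
    have h1 : 0 < 1 - x := by linarith [hx.2]
    rw [Real.norm_eq_abs, abs_div, abs_of_pos h1, div_le_iff₀ h1, ← div_div, abs_div _ (1 - x),
      abs_of_pos h1, mul_assoc, div_mul_cancel₀ _ h1.ne']
    exact Real.abs_exp_sub_one_le hx2
  have hx : Tendsto (fun x : ℝ => x) (𝓝[<] 1) (𝓝 1) := nhdsWithin_le_nhds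
  have := (hx.mul hz).const_sub 1
  rw [mul_zero, sub_zero] at this
  refine this.congr' ?_
  filter_upwards [eventually_mem_Ioo_nhdsLT_one] with x hx
  have : (1 - x) ≠ 0 := by linarith [hx.2]
  field_simp
  ring

theorem tendsto_tsum_one_add_div_rpow {β : ℝ} {N : ℝ → ℕ}
    (hN : Tendsto (fun x => N x * (1 - x)) (𝓝[<] 1) atTop) :
    (∀ᶠ x in 𝓝[<] 1, Summable fun j : ℕ => (1 + (j : ℝ) / N x) ^ β * x ^ j) ∧
    Tendsto (fun x => (1 - x) * ∑' j : ℕ, (1 + (j : ℝ) / N x) ^ β * x ^ j) (𝓝[<] 1) (𝓝 1) := by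
  have hq := tendsto_ratio_mul_exp (β := β) hN
  have hq1 : ∀ᶠ x in 𝓝[<] 1, 0 ≤ x * Real.exp (β / N x) ∧ x * Real.exp (β / N x) < 1 := by
    filter_upwards [eventually_mem_Ioo_nhdsLT_one, hq.eventually (lt_mem_nhds one_pos)] with x hx h
    have h1 : 0 < 1 - x := by linarith [hx.2]
    have := (div_pos_iff_of_pos_right h1).1 h
    exact ⟨mul_nonneg hx.1.le (Real.exp_pos _).le, by linarith⟩
  have hpow (x : ℝ) (j : ℕ) :
      Real.exp (β * ((j : ℝ) / N x)) * x ^ j = (x * Real.exp (β / N x)) ^ j := by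
    rw [mul_pow, ← Real.exp_nat_mul, mul_comm]
    congr 2
    ring
  have hlim : Tendsto (fun x => (1 - x) * (1 - x * Real.exp (β / N x))⁻¹) (𝓝[<] 1) (𝓝 1) := by
    have := hq.inv₀ one_ne_zero
    rw [inv_one] at this
    refine this.congr fun x => ?_
    rw [inv_div, div_eq_mul_inv]
  have hone : Tendsto (fun x : ℝ => (1 - x) * (1 - x)⁻¹) (𝓝[<] 1) (𝓝 1) := by
    refine tendsto_const_nhds.congr' ?_
    filter_upwards [eventually_mem_Ioo_nhdsLT_one] with x hx
    rw [mul_inv_cancel₀ (by linarith [hx.2])]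
  rcases le_total 0 β with hβ | hβ
  · have key : ∀ᶠ x in 𝓝[<] 1, Summable (fun j : ℕ => (1 + (j : ℝ) / N x) ^ β * x ^ j) ∧
        (1 - x)⁻¹ ≤ ∑' j : ℕ, (1 + (j : ℝ) / N x) ^ β * x ^ j ∧
        ∑' j : ℕ, (1 + (j : ℝ) / N x) ^ β * x ^ j ≤ (1 - x * Real.exp (β / N x))⁻¹ := by
      filter_upwards [eventually_mem_Ioo_nhdsLT_one, hq1] with x hx h
      have hle (j : ℕ) : (1 + (j : ℝ) / N x) ^ β * x ^ j ≤ (x * Real.exp (β / N x)) ^ j := by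
        rw [← hpow]
        exact mul_le_mul_of_nonneg_right (one_add_rpow_le_exp hβ (by positivity))
          (pow_nonneg hx.1.le j)
      have hge (j : ℕ) : x ^ j ≤ (1 + (j : ℝ) / N x) ^ β * x ^ j :=
        le_mul_of_one_le_left (pow_nonneg hx.1.le j)
          (Real.one_le_rpow (le_add_of_nonneg_right (by positivity)) hβ)
      have hsq := summable_geometric_of_lt_one h.1 h.2
      have hsum := hsq.of_nonneg_of_le (fun j => (pow_nonneg hx.1.le j).trans (hge j)) hle
      refine ⟨hsum, ?_, ?_⟩
      · rw [← tsum_geometric_of_lt_one hx.1.le hx.2]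
        exact (summable_geometric_of_lt_one hx.1.le hx.2).tsum_le_tsum hge hsum
      · rw [← tsum_geometric_of_lt_one h.1 h.2]
        exact hsum.tsum_le_tsum hle hsq
    refine ⟨key.mono fun x h => h.1, tendsto_of_tendsto_of_tendsto_of_le_of_le' hone hlim ?_ ?_⟩
    all_goals
      filter_upwards [eventually_mem_Ioo_nhdsLT_one, key] with x hx h
      have h1 : 0 ≤ 1 - x := by linarith [hx.2]
      first
        | exact mul_le_mul_of_nonneg_left h.2.1 h1
        | exact mul_le_mul_of_nonneg_left h.2.2 h1
  · have key : ∀ᶠ x in 𝓝[<] 1, Summable (fun j : ℕ => (1 + (j : ℝ) / N x) ^ β * x ^ j) ∧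
        ∑' j : ℕ, (1 + (j : ℝ) / N x) ^ β * x ^ j ≤ (1 - x)⁻¹ ∧
        (1 - x * Real.exp (β / N x))⁻¹ ≤ ∑' j : ℕ, (1 + (j : ℝ) / N x) ^ β * x ^ j := by
      filter_upwards [eventually_mem_Ioo_nhdsLT_one, hq1] with x hx h
      have hge (j : ℕ) : (x * Real.exp (β / N x)) ^ j ≤ (1 + (j : ℝ) / N x) ^ β * x ^ j := by
        rw [← hpow]
        exact mul_le_mul_of_nonneg_right (exp_le_one_add_rpow hβ (by positivity))
          (pow_nonneg hx.1.le j)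
      have hle (j : ℕ) : (1 + (j : ℝ) / N x) ^ β * x ^ j ≤ x ^ j :=
        mul_le_of_le_one_left (pow_nonneg hx.1.le j)
          (Real.rpow_le_one_of_one_le_of_nonpos (le_add_of_nonneg_right (by positivity)) hβ)
      have hsx := summable_geometric_of_lt_one hx.1.le hx.2
      have hsum := hsx.of_nonneg_of_le (fun j => (pow_nonneg h.1 j).trans (hge j)) hle
      refine ⟨hsum, ?_, ?_⟩
      · rw [← tsum_geometric_of_lt_one hx.1.le hx.2]
        exact hsum.tsum_le_tsum hle hsx
      · rw [← tsum_geometric_of_lt_one h.1 h.2]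
        exact (summable_geometric_of_lt_one h.1 h.2).tsum_le_tsum hge hsum
    refine ⟨key.mono fun x h => h.1, tendsto_of_tendsto_of_tendsto_of_le_of_le' hlim hone ?_ ?_⟩
    all_goals
      filter_upwards [eventually_mem_Ioo_nhdsLT_one, key] with x hx h
      have h1 : 0 ≤ 1 - x := by linarith [hx.2]
      first
        | exact mul_le_mul_of_nonneg_left h.2.1 h1
        | exact mul_le_mul_of_nonneg_left h.2.2 h1

theorem tendsto_neg_log_one_sub : Tendsto (fun x : ℝ => -Real.log (1 - x)) (𝓝[<] 1) atTop :=
  tendsto_neg_atBot_atTop.comp (Real.tendsto_log_nhdsGT_zero.comp tendsto_one_sub_nhdsLT_one)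

theorem abs_log_one_sub {x : ℝ} (hx : 0 < x ∧ x < 1) :
    |Real.log (1 - x)| = -Real.log (1 - x) :=
  abs_of_nonpos (Real.log_nonpos (by linarith [hx.2]) (by linarith [hx.1]))

theorem tendsto_div_neg_log_one_sub {c β : ℝ} {A : ℝ → ℝ}
    (hA : ∀ x : ℝ, A x = (β + 1) * |Real.log (1 - x)| + β * Real.log |Real.log (1 - x)|
      + β * Real.log (β + 1) + Real.log c) :
    Tendsto (fun x => A x / -Real.log (1 - x)) (𝓝[<] 1) (𝓝 (β + 1)) := by
  have hL := tendsto_neg_log_one_sub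
  have h1 : Tendsto (fun x : ℝ => Real.log (-Real.log (1 - x)) / -Real.log (1 - x))
      (𝓝[<] 1) (𝓝 0) :=
    Real.isLittleO_log_id_atTop.tendsto_div_nhds_zero.comp hL
  have h2 := (h1.const_mul β).add (hL.const_div_atTop (β * Real.log (β + 1) + Real.log c))
  have h3 := h2.const_add (β + 1)
  rw [mul_zero, add_zero, add_zero] at h3
  refine h3.congr' ?_
  filter_upwards [eventually_mem_Ioo_nhdsLT_one, hL.eventually_gt_atTop 0] with x hx hLx
  rw [hA, abs_log_one_sub hx]
  have := hLx.ne'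
  generalize -Real.log (1 - x) = L at *
  field_simp
  ring

theorem tendsto_atTop_of_div_neg_log_one_sub {B : ℝ → ℝ} {a : ℝ} (ha : 0 < a)
    (hB : Tendsto (fun x => B x / -Real.log (1 - x)) (𝓝[<] 1) (𝓝 a)) :
    Tendsto B (𝓝[<] 1) atTop := by
  refine (hB.pos_mul_atTop ha tendsto_neg_log_one_sub).congr' ?_
  filter_upwards [tendsto_neg_log_one_sub.eventually_gt_atTop 0] with x hx
  rw [div_mul_cancel₀ _ hx.ne']

theorem tendsto_mul_one_sub_of_div_neg_log_one_sub {B : ℝ → ℝ} {a : ℝ}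
    (hB : Tendsto (fun x => B x / -Real.log (1 - x)) (𝓝[<] 1) (𝓝 a)) :
    Tendsto (fun x => B x * (1 - x)) (𝓝[<] 1) (𝓝 0) := by
  have h1 : Tendsto (fun y : ℝ => Real.log y * y) (𝓝[>] 0) (𝓝 0) := by
    simpa using tendsto_log_mul_rpow_nhdsGT_zero one_pos
  have h2 := hB.mul (h1.comp tendsto_one_sub_nhdsLT_one).neg
  rw [neg_zero, mul_zero] at h2
  refine h2.congr' ?_
  filter_upwards [tendsto_neg_log_one_sub.eventually_gt_atTop 0] with x hx
  have : Real.log (1 - x) ≠ 0 := by linarith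
  simp only [Function.comp]
  field_simp

theorem tendsto_div_neg_log_one_sub_of_sub {A B : ℝ → ℝ} {a s : ℝ}
    (hA : Tendsto (fun x => A x / -Real.log (1 - x)) (𝓝[<] 1) (𝓝 a))
    (hB : Tendsto (fun x => B x - A x) (𝓝[<] 1) (𝓝 s)) :
    Tendsto (fun x => B x / -Real.log (1 - x)) (𝓝[<] 1) (𝓝 a) := by
  have h := hA.add (hB.div_atTop tendsto_neg_log_one_sub)
  rw [add_zero] at h
  refine h.congr fun x => ?_
  ring

theorem tendsto_nat_mul_log_add_one_sub {N : ℝ → ℕ}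
    (hN : Tendsto (fun x => N x * (1 - x) * (1 - x)) (𝓝[<] 1) (𝓝 0)) :
    Tendsto (fun x => N x * (Real.log x + (1 - x))) (𝓝[<] 1) (𝓝 0) := by
  have hx : Tendsto (fun x : ℝ => x) (𝓝[<] 1) (𝓝 1) := nhdsWithin_le_nhds
  have h := (hN.div hx one_ne_zero).neg
  rw [zero_div, neg_zero] at h
  refine tendsto_of_tendsto_of_tendsto_of_le_of_le' h tendsto_const_nhds ?_ ?_
  · filter_upwards [eventually_mem_Ioo_nhdsLT_one] with x hx
    have h1 := Real.one_sub_inv_le_log_of_pos hx.1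
    have h2 : -((N x : ℝ) * (1 - x) * (1 - x) / x) = N x * (1 - x⁻¹ + (1 - x)) := by
      have := hx.1.ne'
      field_simp
      ring
    simp only [Pi.div_apply]
    rw [h2]
    exact mul_le_mul_of_nonneg_left (by linarith) (Nat.cast_nonneg _)
  · filter_upwards [eventually_mem_Ioo_nhdsLT_one] with x hx
    have := Real.log_le_sub_one_of_pos hx.1
    exact mul_nonpos_of_nonneg_of_nonpos (Nat.cast_nonneg _) (by linarith)

section Tail

variable {c β s : ℝ} {A : ℝ → ℝ} {N : ℝ → ℕ}

theorem tendsto_first_term_div (hc : 0 < c) (hβ : -1 < β)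
    (hA : ∀ x : ℝ, A x = (β + 1) * |Real.log (1 - x)| + β * Real.log |Real.log (1 - x)|
      + β * Real.log (β + 1) + Real.log c)
    (hN : Tendsto (fun x => N x * (1 - x) - A x) (𝓝[<] 1) (𝓝 s)) :
    Tendsto (fun x => c * (N x : ℝ) ^ β * x ^ N x / (1 - x)) (𝓝[<] 1) (𝓝 (Real.exp (-s))) := by
  have hβ' : 0 < β + 1 := by linarith
  have hw := tendsto_div_neg_log_one_sub_of_sub (tendsto_div_neg_log_one_sub hA) hN
  have hlog := ((hw.log hβ'.ne').sub_const (Real.log (β + 1))).const_mul β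
  have hsum := (hN.neg.add hlog).add
    (tendsto_nat_mul_log_add_one_sub (tendsto_mul_one_sub_of_div_neg_log_one_sub hw))
  rw [sub_self, mul_zero, add_zero, add_zero] at hsum
  refine (Real.continuous_exp.tendsto _ |>.comp hsum).congr' ?_
  filter_upwards [eventually_mem_Ioo_nhdsLT_one, tendsto_neg_log_one_sub.eventually_gt_atTop 0,
    (tendsto_atTop_of_div_neg_log_one_sub hβ' hw).eventually_gt_atTop 0] with x hx hL hwx
  have h1 : 0 < 1 - x := by linarith [hx.2]
  have hNx : (0 : ℝ) < N x := (pos_iff_pos_of_mul_pos hwx).2 h1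
  have hpos : 0 < c * (N x : ℝ) ^ β * x ^ N x / (1 - x) := by
    have := hx.1
    positivity
  rw [Function.comp, ← Real.exp_log hpos, Real.log_div (by have := hx.1; positivity) h1.ne',
    Real.log_mul (by positivity) (pow_pos hx.1 _).ne', Real.log_mul hc.ne' (by positivity),
    Real.log_rpow hNx, Real.log_pow, Real.log_div hwx.ne' hL.ne', Real.log_mul hNx.ne' h1.ne',
    hA, abs_log_one_sub hx]
  congr 1
  ring

theorem tendsto_tail_sum (hc : 0 < c) (hβ : -1 < β)
    (hA : ∀ x : ℝ, A x = (β + 1) * |Real.log (1 - x)| + β * Real.log |Real.log (1 - x)|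
      + β * Real.log (β + 1) + Real.log c)
    (hN : Tendsto (fun x => N x * (1 - x) - A x) (𝓝[<] 1) (𝓝 s)) :
    (∀ᶠ x in 𝓝[<] 1, Summable fun k : ℕ => c * (k : ℝ) ^ β * x ^ k) ∧
    Tendsto (fun x => ∑' j : ℕ, c * ((j + N x : ℕ) : ℝ) ^ β * x ^ (j + N x)) (𝓝[<] 1)
      (𝓝 (Real.exp (-s))) := by
  have hβ' : 0 < β + 1 := by linarith
  have hw := tendsto_atTop_of_div_neg_log_one_sub hβ'
    (tendsto_div_neg_log_one_sub_of_sub (tendsto_div_neg_log_one_sub hA) hN)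
  obtain ⟨hs, hlim⟩ := tendsto_tsum_one_add_div_rpow (β := β) hw
  have key : ∀ᶠ x in 𝓝[<] 1, ∀ j : ℕ, c * ((j + N x : ℕ) : ℝ) ^ β * x ^ (j + N x) =
      c * (N x : ℝ) ^ β * x ^ N x * ((1 + (j : ℝ) / N x) ^ β * x ^ j) := by
    filter_upwards [eventually_mem_Ioo_nhdsLT_one, hw.eventually_gt_atTop 0] with x hx hwx j
    have hNx : (0 : ℝ) < N x := (pos_iff_pos_of_mul_pos hwx).2 (by linarith [hx.2])
    have : ((j + N x : ℕ) : ℝ) = N x * (1 + (j : ℝ) / N x) := by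
      push_cast
      field_simp
      ring
    rw [this, Real.mul_rpow hNx.le (by positivity), pow_add]
    ring
  constructor
  · filter_upwards [key, hs] with x hk h
    rw [← summable_nat_add_iff (N x)]
    exact (h.mul_left _).congr fun j => (hk j).symm
  · have h := (tendsto_first_term_div hc hβ hA hN).mul hlim
    rw [mul_one] at h
    refine h.congr' ?_
    filter_upwards [eventually_mem_Ioo_nhdsLT_one, key] with x hx hk
    have h1 : 1 - x ≠ 0 := by linarith [hx.2]
    rw [tsum_congr hk, tsum_mul_left]
    field_simp

end Tail

theorem tsum_ite_le_nat (f : ℕ → ℝ) (n : ℕ) :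
    ∑' k : ℕ, (if n ≤ k then f k else 0) = ∑' j : ℕ, f (j + n) := by
  rw [← (add_left_injective n).tsum_eq]
  · exact tsum_congr fun j => if_pos (Nat.le_add_left n j)
  · intro k hk
    have h : n ≤ k := by
      by_contra h
      simp [h] at hk
    exact ⟨k - n, Nat.sub_add_cancel h⟩

theorem summable_ite_le_nat {f : ℕ → ℝ} (n : ℕ) (hf : Summable fun j => f (j + n)) :
    Summable fun k : ℕ => if n ≤ k then f k else 0 := by
  rw [← summable_nat_add_iff n]
  exact hf.congr fun j => (if_pos (Nat.le_add_left n j)).symm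

theorem tsum_ite_Icc {f : ℕ → ℝ} (hf : Summable f) {a b : ℝ} (hb : 0 ≤ b) (hab : a ≤ b) :
    ∑' k : ℕ, (if a ≤ (k : ℝ) ∧ (k : ℝ) ≤ b then f k else 0) =
      ∑' j : ℕ, f (j + ⌈a⌉₊) - ∑' j : ℕ, f (j + (⌊b⌋₊ + 1)) := by
  rw [← tsum_ite_le_nat, ← tsum_ite_le_nat, ← Summable.tsum_sub
    (summable_ite_le_nat _ ((summable_nat_add_iff _).2 hf))
    (summable_ite_le_nat _ ((summable_nat_add_iff _).2 hf))]
  refine tsum_congr fun k => ?_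
  simp only [Nat.ceil_le, Nat.succ_le_iff, Nat.floor_lt hb]
  by_cases h1 : a ≤ k <;> by_cases h2 : b < k
  · simp [h1, h2]
  · simp [h1, h2, not_lt.1 h2]
  · exact absurd (hab.trans h2.le) h1
  · simp [h1, h2]

section Rounding

variable {A : ℝ → ℝ}

theorem tendsto_of_abs_sub_le_one_sub {s : ℝ} {u : ℝ → ℝ}
    (h : ∀ᶠ x in 𝓝[<] 1, |u x - s| ≤ 1 - x) : Tendsto u (𝓝[<] 1) (𝓝 s) := by
  rw [tendsto_iff_norm_sub_tendsto_zero]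
  exact squeeze_zero' (Eventually.of_forall fun x => norm_nonneg _) h
    (tendsto_one_sub_nhdsLT_one.mono_right nhdsWithin_le_nhds)

theorem eventually_div_one_sub_nonneg (hA : Tendsto A (𝓝[<] 1) atTop) (s : ℝ) :
    ∀ᶠ x in 𝓝[<] 1, 0 ≤ (A x + s) / (1 - x) := by
  filter_upwards [eventually_mem_Ioo_nhdsLT_one, hA.eventually_ge_atTop (-s)] with x hx h
  exact div_nonneg (by linarith) (by linarith [hx.2])

theorem tendsto_ceil_mul_sub (hA : Tendsto A (𝓝[<] 1) atTop) (s : ℝ) :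
    Tendsto (fun x => (⌈(A x + s) / (1 - x)⌉₊ : ℝ) * (1 - x) - A x) (𝓝[<] 1) (𝓝 s) := by
  apply tendsto_of_abs_sub_le_one_sub
  filter_upwards [eventually_mem_Ioo_nhdsLT_one, eventually_div_one_sub_nonneg hA s] with x hx h
  have h1 : 0 < 1 - x := by linarith [hx.2]
  have h2 := mul_le_mul_of_nonneg_right (Nat.le_ceil ((A x + s) / (1 - x))) h1.le
  have h3 := mul_le_mul_of_nonneg_right (Nat.ceil_lt_add_one h).le h1.le
  rw [div_mul_cancel₀ _ h1.ne'] at h2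
  rw [add_mul, div_mul_cancel₀ _ h1.ne'] at h3
  rw [abs_le]
  constructor <;> linarith

theorem tendsto_floor_add_one_mul_sub (hA : Tendsto A (𝓝[<] 1) atTop) (s : ℝ) :
    Tendsto (fun x => ((⌊(A x + s) / (1 - x)⌋₊ + 1 : ℕ) : ℝ) * (1 - x) - A x)
      (𝓝[<] 1) (𝓝 s) := by
  apply tendsto_of_abs_sub_le_one_sub
  filter_upwards [eventually_mem_Ioo_nhdsLT_one, eventually_div_one_sub_nonneg hA s] with x hx h
  have h1 : 0 < 1 - x := by linarith [hx.2]
  have h2 := mul_le_mul_of_nonneg_right (Nat.lt_floor_add_one ((A x + s) / (1 - x))).le h1.le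
  have h3 := mul_le_mul_of_nonneg_right (Nat.floor_le h) h1.le
  rw [div_mul_cancel₀ _ h1.ne'] at h2 h3
  push_cast
  rw [abs_le]
  constructor <;> linarith

end Rounding

section Limits

variable {c β : ℝ} {A : ℝ → ℝ}

theorem tendsto_window_sum (hc : 0 < c) (hβ : -1 < β)
    (hA : ∀ x : ℝ, A x = (β + 1) * |Real.log (1 - x)| + β * Real.log |Real.log (1 - x)|
      + β * Real.log (β + 1) + Real.log c)
    (s : ℝ) {δ : ℝ} (hδ : 0 < δ) :
    Tendsto (fun x : ℝ => ∑' k : ℕ,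
        if (A x + s) / (1 - x) ≤ (k : ℝ) ∧ (k : ℝ) ≤ (A x + s + δ) / (1 - x)
        then c * (k : ℝ) ^ β * x ^ k else 0)
      (𝓝[<] 1) (𝓝 (Real.exp (-s) * (1 - Real.exp (-δ)))) := by
  have hA' := tendsto_atTop_of_div_neg_log_one_sub (by linarith) (tendsto_div_neg_log_one_sub hA)
  obtain ⟨hsum, h1⟩ := tendsto_tail_sum hc hβ hA (tendsto_ceil_mul_sub hA' s)
  obtain ⟨-, h2⟩ := tendsto_tail_sum hc hβ hA (tendsto_floor_add_one_mul_sub hA' (s + δ))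
  have h := h1.sub h2
  rw [show Real.exp (-s) - Real.exp (-(s + δ)) = Real.exp (-s) * (1 - Real.exp (-δ)) by
    rw [neg_add, Real.exp_add]; ring] at h
  refine h.congr' ?_
  filter_upwards [eventually_mem_Ioo_nhdsLT_one, hsum,
    eventually_div_one_sub_nonneg hA' (s + δ)] with x hx hs hnn
  have hle : (A x + s) / (1 - x) ≤ (A x + s + δ) / (1 - x) :=
    div_le_div_of_nonneg_right (by linarith) (by linarith [hx.2])
  rw [← add_assoc] at hnn ⊢
  exact (tsum_ite_Icc hs hnn hle).symm

theorem log_one_sub_bounds {y z : ℝ} (hy : 0 ≤ y) (hyz : y ≤ z) (hz : z < 1) :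
    -(y * (1 - z)⁻¹) ≤ Real.log (1 - y) ∧ Real.log (1 - y) ≤ -y := by
  have hy1 : 0 < 1 - y := by linarith
  constructor
  · have h := Real.one_sub_inv_le_log_of_pos hy1
    have h2 : 1 - (1 - y)⁻¹ = -(y * (1 - y)⁻¹) := by
      field_simp
      ring
    have h3 : y * (1 - y)⁻¹ ≤ y * (1 - z)⁻¹ :=
      mul_le_mul_of_nonneg_left (inv_anti₀ (by linarith) (by linarith)) hy
    linarith
  · linarith [Real.log_le_sub_one_of_pos hy1]

theorem tsum_mul_log_one_sub_pow_bounds {b : ℕ → ℝ} (hb : ∀ k, 0 ≤ b k) {x : ℝ} (hx : 0 < x)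
    (hx1 : x < 1) {m : ℕ} (hm : m ≠ 0) (hs : Summable fun j => b (j + m) * x ^ (j + m)) :
    (Summable fun j => b (j + m) * Real.log (1 - x ^ (j + m))) ∧
    -((∑' j, b (j + m) * x ^ (j + m)) * (1 - x ^ m)⁻¹) ≤
      ∑' j, b (j + m) * Real.log (1 - x ^ (j + m)) ∧
    ∑' j, b (j + m) * Real.log (1 - x ^ (j + m)) ≤ -∑' j, b (j + m) * x ^ (j + m) := by
  have hbd (j : ℕ) := log_one_sub_bounds (pow_nonneg hx.le (j + m))
    (pow_le_pow_of_le_one hx.le hx1.le (Nat.le_add_left m j)) (pow_lt_one₀ hx.le hx1 hm)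
  have hlo (j : ℕ) : -(b (j + m) * x ^ (j + m) * (1 - x ^ m)⁻¹) ≤
      b (j + m) * Real.log (1 - x ^ (j + m)) := by
    have := mul_le_mul_of_nonneg_left (hbd j).1 (hb (j + m))
    linarith
  have hhi (j : ℕ) : b (j + m) * Real.log (1 - x ^ (j + m)) ≤ -(b (j + m) * x ^ (j + m)) := by
    have := mul_le_mul_of_nonneg_left (hbd j).2 (hb (j + m))
    linarith
  have hs' := hs.mul_right (1 - x ^ m)⁻¹
  have hsum : Summable fun j => b (j + m) * Real.log (1 - x ^ (j + m)) := by
    rw [← summable_neg_iff]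
    refine hs'.of_nonneg_of_le (fun j => ?_) fun j => neg_le.1 (hlo j)
    have := mul_nonneg (hb (j + m)) (pow_nonneg hx.le (j + m))
    linarith [hhi j]
  refine ⟨hsum, ?_, ?_⟩
  · rw [← tsum_mul_right, ← tsum_neg]
    exact hs'.neg.tsum_le_tsum hlo hsum
  · rw [← tsum_neg]
    exact hsum.tsum_le_tsum hhi hs.neg

theorem tprod_ite_one_sub_pow_rpow {b : ℕ → ℝ} {x : ℝ} (hx : 0 < x) (hx1 : x < 1) {r : ℝ}
    (hr : 0 ≤ r)
    (hs : Summable fun j =>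
      b (j + (⌊r⌋₊ + 1)) * Real.log (1 - x ^ (j + (⌊r⌋₊ + 1)))) :
    ∏' k : ℕ, (if r < (k : ℝ) then (1 - x ^ k) ^ b k else 1) =
      Real.exp (∑' j, b (j + (⌊r⌋₊ + 1)) * Real.log (1 - x ^ (j + (⌊r⌋₊ + 1)))) := by
  have hpos {k : ℕ} (hk : ⌊r⌋₊ + 1 ≤ k) : 0 < 1 - x ^ k :=
    sub_pos.2 (pow_lt_one₀ hx.le hx1 (by omega))
  have hlog : (fun k : ℕ => Real.log (if r < (k : ℝ) then (1 - x ^ k) ^ b k else 1)) =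
      fun k => if ⌊r⌋₊ + 1 ≤ k then b k * Real.log (1 - x ^ k) else 0 := by
    funext k
    simp only [← Nat.floor_lt hr, Nat.succ_le_iff]
    split_ifs with h
    · exact Real.log_rpow (hpos h) _
    · exact Real.log_one
  rw [← Real.rexp_tsum_eq_tprod, hlog, tsum_ite_le_nat (fun k => b k * Real.log (1 - x ^ k))]
  · intro k
    split_ifs with h
    · exact Real.rpow_pos_of_pos (hpos ((Nat.floor_lt hr).2 h)) _
    · exact one_pos
  · rw [hlog]
    exact summable_ite_le_nat _ hs

theorem tendsto_pow_nat_of_mul_one_sub {N : ℝ → ℕ}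
    (hN : Tendsto (fun x => N x * (1 - x)) (𝓝[<] 1) atTop) :
    Tendsto (fun x => x ^ N x) (𝓝[<] 1) (𝓝 0) := by
  refine squeeze_zero' ?_ ?_ (Real.tendsto_exp_neg_atTop_nhds_zero.comp hN)
  · filter_upwards [eventually_mem_Ioo_nhdsLT_one] with x hx
    exact pow_nonneg hx.1.le _
  · filter_upwards [eventually_mem_Ioo_nhdsLT_one] with x hx
    rw [Function.comp, ← mul_neg, Real.exp_nat_mul]
    exact pow_le_pow_left₀ hx.1.le (by linarith [Real.add_one_le_exp (-(1 - x))]) _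

theorem tendsto_tail_prod (hc : 0 < c) (hβ : -1 < β)
    (hA : ∀ x : ℝ, A x = (β + 1) * |Real.log (1 - x)| + β * Real.log |Real.log (1 - x)|
      + β * Real.log (β + 1) + Real.log c)
    (s : ℝ) :
    Tendsto (fun x : ℝ => ∏' k : ℕ, if (A x + s) / (1 - x) < (k : ℝ)
        then (1 - x ^ k) ^ (c * (k : ℝ) ^ β) else 1)
      (𝓝[<] 1) (𝓝 (Real.exp (-Real.exp (-s)))) := by
  have hβ' : 0 < β + 1 := by linarith
  have hAL := tendsto_div_neg_log_one_sub hA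
  have hA' := tendsto_atTop_of_div_neg_log_one_sub hβ' hAL
  have hN := tendsto_floor_add_one_mul_sub hA' s
  have hpow := tendsto_pow_nat_of_mul_one_sub (tendsto_atTop_of_div_neg_log_one_sub hβ'
    (tendsto_div_neg_log_one_sub_of_sub hAL hN))
  obtain ⟨hsum, hT⟩ := tendsto_tail_sum hc hβ hA hN
  have hlow := (hT.mul ((hpow.const_sub 1).inv₀ (by simp))).neg
  rw [sub_zero, inv_one, mul_one] at hlow
  have key : ∀ᶠ x in 𝓝[<] 1,
      (Summable fun j : ℕ => c * ((j + (⌊(A x + s) / (1 - x)⌋₊ + 1) : ℕ) : ℝ) ^ β *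
        Real.log (1 - x ^ (j + (⌊(A x + s) / (1 - x)⌋₊ + 1)))) ∧
      -((∑' j : ℕ, c * ((j + (⌊(A x + s) / (1 - x)⌋₊ + 1) : ℕ) : ℝ) ^ β *
          x ^ (j + (⌊(A x + s) / (1 - x)⌋₊ + 1))) *
          (1 - x ^ (⌊(A x + s) / (1 - x)⌋₊ + 1))⁻¹) ≤
        ∑' j : ℕ, c * ((j + (⌊(A x + s) / (1 - x)⌋₊ + 1) : ℕ) : ℝ) ^ β *
          Real.log (1 - x ^ (j + (⌊(A x + s) / (1 - x)⌋₊ + 1))) ∧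
      ∑' j : ℕ, c * ((j + (⌊(A x + s) / (1 - x)⌋₊ + 1) : ℕ) : ℝ) ^ β *
          Real.log (1 - x ^ (j + (⌊(A x + s) / (1 - x)⌋₊ + 1))) ≤
        -∑' j : ℕ, c * ((j + (⌊(A x + s) / (1 - x)⌋₊ + 1) : ℕ) : ℝ) ^ β *
          x ^ (j + (⌊(A x + s) / (1 - x)⌋₊ + 1)) := by
    filter_upwards [eventually_mem_Ioo_nhdsLT_one, hsum] with x hx hs
    exact tsum_mul_log_one_sub_pow_bounds (b := fun k : ℕ => c * (k : ℝ) ^ β)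
      (fun k => by positivity) hx.1 hx.2 (Nat.succ_ne_zero ⌊(A x + s) / (1 - x)⌋₊)
      ((summable_nat_add_iff (f := fun k : ℕ => c * (k : ℝ) ^ β * x ^ k) _).2 hs)
  have hlim := tendsto_of_tendsto_of_tendsto_of_le_of_le' hlow hT.neg
    (key.mono fun x h => h.2.1) (key.mono fun x h => h.2.2)
  refine (Real.continuous_exp.tendsto _ |>.comp hlim).congr' ?_
  filter_upwards [eventually_mem_Ioo_nhdsLT_one, eventually_div_one_sub_nonneg hA' s, key]
    with x hx hr hk
  exact (tprod_ite_one_sub_pow_rpow (b := fun k : ℕ => c * (k : ℝ) ^ β) hx.1 hx.2 hr hk.1).symm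

end Limits

/-- **Theorem 4 (upper order statistics).** For the generalized Bose–Einstein
statistics with `b_k = c k^β`, `t_1 > ⋯ > t_d` and `δ > 0` such that the intervals
`[t_i, t_i + δ]` are pairwise disjoint, the product of the window sums
`S_i = ∑_{(A(x)+t_i)/(1-x) ≤ k ≤ (A(x)+t_i+δ)/(1-x)} c k^β x^k` times the tail
product `∏_{k > (A(x)+t_d)/(1-x)} (1-x^k)^{c k^β}` converges to
`exp(-e^{-t_d}) ∏_i e^{-t_i}(1-e^{-δ})` as `x → 1⁻`. -/
theorem stmt_13 (c β : ℝ) (hc : 0 < c) (hβ : -1 < β)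
    (A : ℝ → ℝ)
    (hA : ∀ x : ℝ, A x = (β + 1) * |Real.log (1 - x)| + β * Real.log |Real.log (1 - x)|
      + β * Real.log (β + 1) + Real.log c)
    (d : ℕ) (hd : 1 ≤ d) (t : Fin d → ℝ) (ht : StrictAnti t)
    (δ : ℝ) (hδ : 0 < δ)
    (hdisj : Pairwise fun i j : Fin d =>
      Disjoint (Set.Icc (t i) (t i + δ)) (Set.Icc (t j) (t j + δ))) :
    Tendsto (fun x : ℝ =>
        (∏ i : Fin d, ∑' k : ℕ,
          if (A x + t i) / (1 - x) ≤ (k : ℝ) ∧ (k : ℝ) ≤ (A x + t i + δ) / (1 - x)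
          then c * (k : ℝ) ^ β * x ^ k else 0) *
        ∏' k : ℕ, if (A x + t ⟨d - 1, by omega⟩) / (1 - x) < (k : ℝ)
          then (1 - x ^ k) ^ (c * (k : ℝ) ^ β) else 1)
      (𝓝[<] (1 : ℝ))
      (𝓝 (Real.exp (-Real.exp (-t ⟨d - 1, by omega⟩)) *
        ∏ i : Fin d, Real.exp (-t i) * (1 - Real.exp (-δ)))) := by
  rw [mul_comm (Real.exp _)]
  exact (tendsto_finsetProd _ fun i _ => tendsto_window_sum hc hβ hA (t i) hδ).mul
    (tendsto_tail_prod hc hβ hA _)
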